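/- arXiv:2212.09188 — 2 statements merged into one kernel-verified Lean document; each statement's English description precedes it below -/
import Mathlib

section
/- For every positive integer n, inv(n) ≥ (n−1)/2 − log₂ n, where inv(n) denotes the maximum inversion number over all tournaments of order n. -/
/-- An oriented graph: a digraph with no loops and no pair of opposite arcs. -/
structure OrientedGraph (V : Type*) where
  arc : V → V → Prop
  irrefl' : ∀ v, ¬ arc v v
  asymm' : ∀ u v, arc u v → ¬ arc v u

namespace OrientedGraph

variable {V : Type*}

/-- An oriented graph is acyclic if it has no directed cycle. -/
def IsAcyclic (D : OrientedGraph V) : Prop := ∀ v, ¬ Relation.TransGen D.arc v v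

/-- The result of inverting the sets `X 0, …, X (k-1)` one after another:
an arc is reversed iff an odd number of the sets contain both of its end-vertices. -/
def invert (D : OrientedGraph V) {k : ℕ} (X : Fin k → Set V) : OrientedGraph V where
  arc u v := (Even {i : Fin k | u ∈ X i ∧ v ∈ X i}.ncard ∧ D.arc u v) ∨
    (¬ Even {i : Fin k | u ∈ X i ∧ v ∈ X i}.ncard ∧ D.arc v u)
  irrefl' v h := by
    rcases h with ⟨_, h⟩ | ⟨_, h⟩ <;> exact D.irrefl' v h
  asymm' u v h1 h2 := by
    have hs : {i : Fin k | v ∈ X i ∧ u ∈ X i} = {i : Fin k | u ∈ X i ∧ v ∈ X i} := by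
      ext i; simp only [Set.mem_setOf_eq]; exact and_comm
    rcases h1 with ⟨hE, h1⟩ | ⟨hE, h1⟩ <;> rcases h2 with ⟨hE', h2⟩ | ⟨hE', h2⟩ <;>
      rw [hs] at hE'
    · exact D.asymm' u v h1 h2
    · exact hE' hE
    · exact hE hE'
    · exact D.asymm' v u h1 h2

/-- A family of subsets is decycling if inverting it yields an acyclic oriented graph. -/
def IsDecycling (D : OrientedGraph V) {k : ℕ} (X : Fin k → Set V) : Prop :=
  (D.invert X).IsAcyclic

/-- The inversion number: the minimum cardinality of a decycling family. -/
noncomputable def inv (D : OrientedGraph V) : ℕ :=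
  sInf {k | ∃ X : Fin k → Set V, D.IsDecycling X}

/-- A tournament: an oriented graph whose underlying graph is complete. -/
def IsTournament (D : OrientedGraph V) : Prop :=
  ∀ u v : V, u ≠ v → D.arc u v ∨ D.arc v u

/-- The subdigraph induced by a set of vertices. -/
def induce (D : OrientedGraph V) (S : Set V) : OrientedGraph S where
  arc a b := D.arc a b
  irrefl' a := D.irrefl' a
  asymm' a b := D.asymm' a b

/-- The dijoin `L ⇒ R`: disjoint union of `L` and `R` plus all arcs from `L` to `R`. -/
def dijoin {α β : Type*} (L : OrientedGraph α) (R : OrientedGraph β) :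
    OrientedGraph (α ⊕ β) where
  arc x y :=
    match x, y with
    | Sum.inl a, Sum.inl b => L.arc a b
    | Sum.inl _, Sum.inr _ => True
    | Sum.inr _, Sum.inl _ => False
    | Sum.inr a, Sum.inr b => R.arc a b
  irrefl' x := by
    cases x with
    | inl a => exact L.irrefl' a
    | inr b => exact R.irrefl' b
  asymm' x y := by
    cases x <;> cases y
    · exact L.asymm' _ _
    · exact fun _ h => h
    · exact fun h _ => h
    · exact R.asymm' _ _

/-- The oriented graph `△(D)`, obtained from `D` by adding two new vertices `u = inr false`
and `v = inr true`, all arcs from `V(D)` to `u`, the arc `u v`, and all arcs from `v`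
to `V(D)`. -/
def triangleExt (D : OrientedGraph V) : OrientedGraph (V ⊕ Bool) where
  arc x y :=
    match x, y with
    | Sum.inl a, Sum.inl b => D.arc a b
    | Sum.inl _, Sum.inr w => w = false
    | Sum.inr w, Sum.inl _ => w = true
    | Sum.inr w, Sum.inr w' => w = false ∧ w' = true
  irrefl' x := by
    cases x with
    | inl a => exact D.irrefl' a
    | inr w => exact fun h => absurd (h.1.symm.trans h.2) (by decide)
  asymm' x y := by
    cases x <;> cases y <;> intro h1 h2
    · exact D.asymm' _ _ h1 h2
    · exact absurd (h1.symm.trans h2) (by decide)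
    · exact absurd (h2.symm.trans h1) (by decide)
    · exact absurd (h1.2.symm.trans h2.1) (by decide)

end OrientedGraph

/-- `maxInv n` is the maximum of the inversion numbers of tournaments of order `n`. -/
noncomputable def maxInv (n : ℕ) : ℕ :=
  sSup {m | ∃ T : OrientedGraph (Fin n), T.IsTournament ∧ T.inv = m}

namespace OrientedGraph

theorem arc_injective {V : Type*} : Function.Injective (OrientedGraph.arc (V := V)) := by
  intro a b h
  cases a; cases b; cases h; rfl

/-- Every oriented graph on `Fin n` has a decycling family. -/
theorem exists_decycling {n : ℕ} (D : OrientedGraph (Fin n)) :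
    ∃ k, ∃ X : Fin k → Set (Fin n), D.IsDecycling X := by
  classical
  let E : Finset (Fin n × Fin n) := Finset.univ.filter fun p => p.1 < p.2 ∧ D.arc p.2 p.1
  let e := E.equivFin
  let X : Fin E.card → Set (Fin n) := fun i => {(e.symm i).1.1, (e.symm i).1.2}
  have key : ∀ u v : Fin n, u < v → ∀ i, (u ∈ X i ∧ v ∈ X i) ↔ (e.symm i).1 = (u, v) := by
    intro u v huv i
    have hE : (e.symm i).1.1 < (e.symm i).1.2 := by
      have := (e.symm i).2
      simp only [E, Finset.mem_filter] at this
      exact this.2.1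
    simp only [X, Set.mem_insert_iff, Set.mem_singleton_iff, Prod.ext_iff]
    constructor
    · rintro ⟨h1, h2⟩
      omega
    · rintro ⟨h1, h2⟩
      exact ⟨Or.inl h1.symm, Or.inr h2.symm⟩
  have odd : ∀ u v : Fin n, u < v → D.arc v u →
      {i | u ∈ X i ∧ v ∈ X i}.ncard = 1 := by
    intro u v huv h
    have hm : (u, v) ∈ E := by simp [E, huv, h]
    rw [Set.ncard_eq_one]
    refine ⟨e ⟨_, hm⟩, ?_⟩
    ext i
    simp only [Set.mem_setOf_eq, Set.mem_singleton_iff, key u v huv]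
    rw [← Equiv.symm_apply_eq, Subtype.ext_iff]
  have even : ∀ u v : Fin n, u < v → ¬ D.arc v u →
      {i | u ∈ X i ∧ v ∈ X i}.ncard = 0 := by
    intro u v huv h
    have : {i | u ∈ X i ∧ v ∈ X i} = ∅ := by
      ext i
      simp only [Set.mem_setOf_eq, key u v huv, Set.mem_empty_iff_false, iff_false]
      intro hi
      have := (e.symm i).2
      rw [hi] at this
      simp [E, h] at this
    rw [this, Set.ncard_empty]
  have harc : ∀ u v, (D.invert X).arc u v → u < v := by
    intro u v h
    by_contra hlt
    rcases lt_or_eq_of_le (not_lt.1 hlt) with hvu | rfl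
    · have hs : {i | u ∈ X i ∧ v ∈ X i} = {i | v ∈ X i ∧ u ∈ X i} := by
        ext i; exact and_comm
      rcases h with ⟨h1, h2⟩ | ⟨h1, h2⟩
      · rw [hs, odd v u hvu h2] at h1
        exact absurd h1 (by decide)
      · rw [hs, even v u hvu (D.asymm' _ _ h2)] at h1
        exact absurd h1 (by decide)
    · exact (D.invert X).irrefl' _ h
  refine ⟨E.card, X, fun v hv => ?_⟩
  have : ∀ a b, Relation.TransGen (D.invert X).arc a b → a < b := by
    intro a b h
    induction h with
    | single h => exact harc _ _ h
    | tail _ h ih => exact ih.trans (harc _ _ h)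
  exact lt_irrefl _ (this v v hv)

theorem decycling_mono {n k K : ℕ} (D : OrientedGraph (Fin n)) (hk : k ≤ K)
    (X : Fin k → Set (Fin n)) (hX : D.IsDecycling X) :
    ∃ Y : Fin K → Set (Fin n), D.IsDecycling Y := by
  refine ⟨fun i => if h : i.1 < k then X ⟨i, h⟩ else ∅, ?_⟩
  set Y : Fin K → Set (Fin n) := fun i => if h : i.1 < k then X ⟨i, h⟩ else ∅ with hY
  have hs : ∀ u v, {i | u ∈ Y i ∧ v ∈ Y i}.ncard = {i | u ∈ X i ∧ v ∈ X i}.ncard := by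
    intro u v
    rw [← Set.ncard_image_of_injective {i | u ∈ X i ∧ v ∈ X i} (Fin.castLE_injective hk)]
    congr 1
    ext i
    simp only [Set.mem_setOf_eq, Set.mem_image, hY]
    constructor
    · intro h
      by_cases hi : i.1 < k
      · simp only [hi, dif_pos] at h
        exact ⟨⟨i, hi⟩, h, rfl⟩
      · simp [hi] at h
    · rintro ⟨j, hj, rfl⟩
      simpa using hj
  have : D.invert Y = D.invert X := by
    apply arc_injective
    funext u v
    simp only [invert, hs]
  unfold IsDecycling
  rw [this]
  exact hX

theorem exists_rank {n : ℕ} (D : OrientedGraph (Fin n)) (h : D.IsAcyclic) :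
    ∃ r : Fin n → Fin n, ∀ u v, D.arc u v → r u < r v := by
  classical
  let A : Fin n → Finset (Fin n) := fun v => Finset.univ.filter fun w => Relation.TransGen D.arc w v
  have hA : ∀ v, v ∉ A v := by
    intro v hv
    simp only [A, Finset.mem_filter] at hv
    exact h v hv.2
  refine ⟨fun v => ⟨(A v).card, ?_⟩, ?_⟩
  · have := Finset.card_lt_univ_of_notMem (hA v)
    simpa using this
  · intro u v huv
    change (A u).card < (A v).card
    apply Finset.card_lt_card
    rw [Finset.ssubset_iff_of_subset]
    · refine ⟨u, ?_, hA u⟩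
      simp only [A, Finset.mem_filter, Finset.mem_univ, true_and]
      exact .single huv
    · intro w hw
      simp only [A, Finset.mem_filter, Finset.mem_univ, true_and] at hw ⊢
      exact hw.tail huv

/-- The tournament coded by a choice of bits. -/
def ofBits {n : ℕ} (B : (v : Fin n) → Fin v.1 → Bool) : OrientedGraph (Fin n) where
  arc u v := (∃ h : u.1 < v.1, B v ⟨u.1, h⟩ = true) ∨ (∃ h : v.1 < u.1, B u ⟨v.1, h⟩ = false)
  irrefl' v h := by
    rcases h with ⟨h, _⟩ | ⟨h, _⟩ <;> exact lt_irrefl _ h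
  asymm' u v h1 h2 := by
    rcases h1 with ⟨h, h1⟩ | ⟨h, h1⟩ <;> rcases h2 with ⟨h', h2⟩ | ⟨h', h2⟩
    · omega
    · rw [h1] at h2; cases h2
    · rw [h1] at h2; cases h2
    · omega

theorem ofBits_isTournament {n : ℕ} (B : (v : Fin n) → Fin v.1 → Bool) :
    (ofBits B).IsTournament := by
  intro u v huv
  rcases lt_or_gt_of_ne (fun h => huv (Fin.ext h) : u.1 ≠ v.1) with h | h
  · cases hb : B v ⟨u.1, h⟩
    · exact Or.inr (Or.inr ⟨h, hb⟩)
    · exact Or.inl (Or.inl ⟨h, hb⟩)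
  · cases hb : B u ⟨v.1, h⟩
    · exact Or.inl (Or.inr ⟨h, hb⟩)
    · exact Or.inr (Or.inl ⟨h, hb⟩)

theorem exists_code {n : ℕ} (B : (v : Fin n) → Fin v.1 → Bool) :
    ∃ p : (Fin (maxInv n) → Set (Fin n)) × (Fin n → Fin n),
      ∀ u v, ((ofBits B).invert p.1).arc u v → p.2 u < p.2 v := by
  have hfin : Finite (OrientedGraph (Fin n)) := Finite.of_injective _ arc_injective
  have hle : (ofBits B).inv ≤ maxInv n := by
    apply le_csSup
    · apply Set.Finite.bddAbove
      apply (Set.finite_range (fun T : OrientedGraph (Fin n) => T.inv)).subset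
      rintro m ⟨T, _, rfl⟩
      exact ⟨T, rfl⟩
    · exact ⟨_, ofBits_isTournament B, rfl⟩
  obtain ⟨X, hX⟩ : ∃ X : Fin (ofBits B).inv → Set (Fin n), (ofBits B).IsDecycling X :=
    Nat.sInf_mem (s := {k | ∃ X : Fin k → Set (Fin n), (ofBits B).IsDecycling X})
      (exists_decycling (ofBits B))
  obtain ⟨Y, hY⟩ := decycling_mono _ hle X hX
  obtain ⟨r, hr⟩ := exists_rank _ hY
  exact ⟨(Y, r), hr⟩

theorem code_inj {n K : ℕ} (B B' : (v : Fin n) → Fin v.1 → Bool)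
    (X : Fin K → Set (Fin n)) (r : Fin n → Fin n)
    (h : ∀ u v, ((ofBits B).invert X).arc u v → r u < r v)
    (h' : ∀ u v, ((ofBits B').invert X).arc u v → r u < r v) : B = B' := by
  have main : ∀ u v, (ofBits B).arc u v → ¬ (ofBits B').arc v u := by
    intro u v h1 h2
    have hs : {i | v ∈ X i ∧ u ∈ X i} = {i | u ∈ X i ∧ v ∈ X i} := by
      ext i; exact and_comm
    by_cases he : Even {i | u ∈ X i ∧ v ∈ X i}.ncard
    · exact lt_asymm (h u v (Or.inl ⟨he, h1⟩)) (h' v u (Or.inl ⟨hs ▸ he, h2⟩))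
    · exact lt_asymm (h v u (Or.inr ⟨hs ▸ he, h1⟩)) (h' u v (Or.inr ⟨he, h2⟩))
  funext v u
  have hu : u.1 < n := u.2.trans v.2
  cases hb : B v u <;> cases hb' : B' v u
  · rfl
  · exact absurd (Or.inl ⟨u.2, hb'⟩) (main v ⟨u.1, hu⟩ (Or.inr ⟨u.2, hb⟩))
  · exact absurd (Or.inr ⟨u.2, hb'⟩) (main ⟨u.1, hu⟩ v (Or.inl ⟨u.2, hb⟩))
  · rfl

theorem count_bound (n : ℕ) :
    2 ^ (∑ i ∈ Finset.range n, i) ≤ (2 ^ n) ^ maxInv n * n ^ n := by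
  choose f hf using exists_code (n := n)
  have hinj : Function.Injective f := by
    intro B B' hBB
    refine code_inj B B' (f B).1 (f B).2 (hf B) ?_
    rw [hBB]
    exact hf B'
  have := Nat.card_le_card_of_injective f hinj
  simp only [Nat.card_eq_fintype_card, Fintype.card_prod, Fintype.card_pi, Fintype.card_set,
    Fintype.card_fin, Fintype.card_bool, Finset.prod_const, Finset.card_univ] at this
  rwa [Finset.prod_pow_eq_pow_sum, Fin.sum_univ_eq_sum_range (fun i => i)] at this

end OrientedGraph

/-- For every positive integer `n`, `inv(n) ≥ (n-1)/2 - log₂ n`. -/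
theorem maxInv_lower_bound (n : ℕ) (hn : 1 ≤ n) :
    ((n : ℝ) - 1) / 2 - Real.logb 2 n ≤ (maxInv n : ℝ) := by
  have hc := OrientedGraph.count_bound n
  have hn0 : (0 : ℝ) < n := by exact_mod_cast hn
  have hc' : (2 : ℝ) ^ (∑ i ∈ Finset.range n, i) ≤ (2 ^ n) ^ maxInv n * (n : ℝ) ^ n := by
    exact_mod_cast hc
  have hl := Real.logb_le_logb_of_le (b := 2) (by norm_num) (by positivity) hc'
  rw [Real.logb_mul (by positivity) (by positivity), ← pow_mul, Real.logb_pow, Real.logb_pow,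
    Real.logb_pow, Real.logb_self_eq_one (by norm_num)] at hl
  have hs : ((∑ i ∈ Finset.range n, i : ℕ) : ℝ) * 2 = n * (n - 1) := by
    have := Finset.sum_range_id_mul_two n
    have h2 : (((∑ i ∈ Finset.range n, i) * 2 : ℕ) : ℝ) = ((n * (n - 1) : ℕ) : ℝ) := by rw [this]
    rw [Nat.cast_mul, Nat.cast_mul, Nat.cast_sub hn] at h2
    exact_mod_cast h2
  push_cast at hl hs
  have : (n : ℝ) * (((n : ℝ) - 1) / 2 - Real.logb 2 n) ≤ n * maxInv n := by linarith
  exact le_of_mul_le_mul_left this hn0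
end

section
/- For every positive integer n, inv(n) ≤ n − ⌈log₂(n+1)⌉, where inv(n) denotes the maximum inversion number over all tournaments of order n; that is, every tournament of order n has a decycling family of size at most n − ⌈log₂(n+1)⌉. -/
namespace OrientedGraph

variable {V : Type*}

/-- Inversion of a single set. -/
def flipSet (D : OrientedGraph V) (X : Set V) : OrientedGraph V where
  arc u v := ((u ∈ X ∧ v ∈ X) ∧ D.arc v u) ∨ (¬ (u ∈ X ∧ v ∈ X) ∧ D.arc u v)
  irrefl' v h := by
    rcases h with ⟨_, h⟩ | ⟨_, h⟩ <;> exact D.irrefl' v h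
  asymm' u v h1 h2 := by
    have a1 := D.asymm' u v
    have a2 := D.asymm' v u
    tauto

/-- Reversal of all arcs. -/
def rev (D : OrientedGraph V) : OrientedGraph V where
  arc u v := D.arc v u
  irrefl' v := D.irrefl' v
  asymm' u v := D.asymm' v u

lemma ncard_cons {k : ℕ} (X0 : Set V) (X : Fin k → Set V) (u v : V) :
    {i : Fin (k+1) | u ∈ (Fin.cons X0 X : Fin (k+1) → Set V) i ∧
      v ∈ (Fin.cons X0 X : Fin (k+1) → Set V) i}.ncard =
    {i : Fin 1 | u ∈ X0 ∧ v ∈ X0}.ncard + {i : Fin k | u ∈ X i ∧ v ∈ X i}.ncard := by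
  classical
  simp only [Set.ncard_eq_toFinset_card', Set.toFinset_setOf, Finset.card_filter]
  rw [Fin.sum_univ_succ]
  simp

lemma invert_cons_arc (D : OrientedGraph V) {k : ℕ} (X0 : Set V) (X : Fin k → Set V) (u v : V) :
    (D.invert (Fin.cons X0 X : Fin (k+1) → Set V)).arc u v ↔
      ((D.flipSet X0).invert X).arc u v := by
  simp only [invert, flipSet, ncard_cons]
  by_cases h : u ∈ X0 ∧ v ∈ X0
  · have h' : v ∈ X0 ∧ u ∈ X0 := ⟨h.2, h.1⟩
    simp only [h, h', and_self, Set.setOf_true, Set.ncard_univ, Nat.card_eq_fintype_card,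
      Fintype.card_fin, Nat.even_add, Nat.not_even_one, not_true, false_and, or_false, true_and]
    tauto
  · have h' : ¬ (v ∈ X0 ∧ u ∈ X0) := fun a => h ⟨a.2, a.1⟩
    simp only [h, h', Set.setOf_false, Set.ncard_empty, zero_add, false_and, false_or,
      not_false_eq_true, true_and]

/-- `D` restricted to `S` can be made acyclic with at most `k` inversions inside `S`. -/
def Dec (D : OrientedGraph V) (S : Finset V) (k : ℕ) : Prop :=
  ∃ (k' : ℕ) (X : Fin k' → Set V) (r : V → ℤ), k' ≤ k ∧ (∀ i, X i ⊆ S) ∧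
    ∀ u ∈ S, ∀ v ∈ S, (D.invert X).arc u v → r u < r v

lemma Dec.mono {D : OrientedGraph V} {S : Finset V} {k l : ℕ} (h : D.Dec S k) (hkl : k ≤ l) :
    D.Dec S l := by
  obtain ⟨k', X, r, h1, h2⟩ := h
  exact ⟨k', X, r, h1.trans hkl, h2⟩

lemma Dec.of_rev {D : OrientedGraph V} {S : Finset V} {k : ℕ} (h : D.rev.Dec S k) :
    D.Dec S k := by
  obtain ⟨k', X, r, h1, h2, h3⟩ := h
  refine ⟨k', X, fun v => - r v, h1, h2, fun u hu v hv ha => ?_⟩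
  have := h3 v hv u hu (by
    have hs : {i : Fin k' | v ∈ X i ∧ u ∈ X i} = {i : Fin k' | u ∈ X i ∧ v ∈ X i} := by
      ext i; simp only [Set.mem_setOf_eq]; exact and_comm
    simpa only [invert, rev, hs] using ha)
  simpa using this

lemma Dec.flip {D : OrientedGraph V} {S : Finset V} {k : ℕ} {X0 : Set V} (hX : X0 ⊆ S)
    (h : (D.flipSet X0).Dec S k) : D.Dec S (k+1) := by
  obtain ⟨k', X, r, h1, h2, h3⟩ := h
  refine ⟨k'+1, Fin.cons X0 X, r, by omega, ?_, fun u hu v hv ha => ?_⟩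
  · intro i
    refine Fin.cases ?_ (fun j => ?_) i
    · simpa using hX
    · simpa using h2 j
  · exact h3 u hu v hv ((invert_cons_arc D X0 X u v).1 ha)

lemma Dec.source [DecidableEq V] {D : OrientedGraph V} {S : Finset V} {k : ℕ} {v : V}
    (hv : v ∉ S) (hs : ∀ w ∈ S, ¬ D.arc w v) (h : D.Dec S k) : D.Dec (insert v S) k := by
  obtain ⟨k', X, r, h1, h2, h3⟩ := h
  obtain ⟨m, hm⟩ := (S.image r).bddBelow
  have hm' : ∀ w ∈ S, m ≤ r w := fun w hw =>
    hm (Finset.mem_coe.2 (Finset.mem_image_of_mem r hw))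
  have hvX : ∀ i, v ∉ X i := fun i hi => hv (Finset.mem_coe.1 (h2 i hi))
  refine ⟨k', X, fun w => if w = v then m - 1 else r w, h1, fun i => (h2 i).trans (by simp), ?_⟩
  intro a ha b hb hab
  rcases Finset.mem_insert.1 ha with rfl | ha2 <;> rcases Finset.mem_insert.1 hb with rfl | hb2
  · exact absurd hab ((D.invert X).irrefl' _)
  · have hba : b ≠ a := fun e => hv (e ▸ hb2)
    have := hm' b hb2
    simp only [if_true, hba, if_false]; omega
  · exfalso
    simp only [invert, hvX, and_false, Set.setOf_false, Set.ncard_empty] at hab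
    simp at hab
    exact hs a ha2 hab
  · have ha' : a ≠ v := fun e => hv (e ▸ ha2)
    have hb' : b ≠ v := fun e => hv (e ▸ hb2)
    simpa [ha', hb'] using h3 a ha2 b hb2 hab

lemma Dec.step [DecidableEq V] {W : Finset V} {v : V} {k : ℕ} (hvW : v ∉ W)
    (hW : ∀ D : OrientedGraph V, D.Dec W k) (U : Finset V) :
    ∀ D : OrientedGraph V, v ∉ U → Disjoint U W → (∀ u ∈ U, D.arc u v) →
      (∀ w ∈ W, ¬ D.arc w v) → D.Dec (U ∪ insert v W) (k + U.card) := by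
  induction U using Finset.induction_on with
  | empty =>
    intro D _ _ _ h
    simpa using (hW D).source hvW h
  | insert u U hu ih =>
    intro D hvU hd hU hWv
    simp only [Finset.mem_insert, not_or] at hvU
    rw [Finset.disjoint_insert_left] at hd
    have huv : D.arc u v := hU u (by simp)
    rw [Finset.insert_union, Finset.card_insert_of_notMem hu, ← add_assoc]
    have huR : u ∉ U ∪ insert v W := by
      simp only [Finset.mem_union, Finset.mem_insert, not_or]
      exact ⟨hu, Ne.symm hvU.1, hd.1⟩
    set R := U ∪ insert v W with hR
    let X0 : Set V := {x | x = u ∨ (x ∈ R ∧ D.arc x u)}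
    have hvX : v ∉ X0 := by
      rintro (h | ⟨_, h⟩)
      · exact hvU.1 h
      · exact D.asymm' _ _ huv h
    have harc : ∀ x, (D.flipSet X0).arc x v ↔ D.arc x v := by
      intro x; simp [flipSet, hvX]
    apply Dec.flip (X0 := X0)
    · rintro x (rfl | h)
      · simp
      · simp [h.1]
    · apply Dec.source huR
      · intro w hw h
        have a1 := D.asymm' u w
        have hwu : w ≠ u := fun e => huR (e ▸ hw)
        simp only [flipSet, X0, Set.mem_setOf_eq, true_or, and_true, hwu, false_or, hw,
          true_and] at h
        tauto
      · apply ih _ hvU.2 hd.2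
        · intro x hx
          exact (harc x).2 (hU x (by simp [hx]))
        · intro x hx h
          exact hWv x hx ((harc x).1 h)

lemma clog_step (n s : ℕ) (h : 2 * s + 1 ≤ n) :
    (n - 1 - s - Nat.clog 2 (n - 1 - s + 1)) + s ≤ n - Nat.clog 2 (n + 1) := by
  have h1 : Nat.clog 2 (n+1) ≤ Nat.clog 2 (n - 1 - s + 1) + 1 := by
    rw [Nat.clog_of_two_le (by norm_num) (by omega : 2 ≤ n+1)]
    exact Nat.add_le_add_right (Nat.clog_mono_right 2 (by omega)) 1
  have h2 : Nat.clog 2 (n - 1 - s + 1) ≤ n - 1 - s :=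
    Nat.clog_le_of_le_pow (Nat.lt_two_pow_self)
  omega

lemma dec_all [DecidableEq V] (n : ℕ) : ∀ (S : Finset V), S.card = n → ∀ D : OrientedGraph V,
    D.Dec S (n - Nat.clog 2 (n + 1)) := by
  classical
  induction n using Nat.strong_induction_on with
  | _ n ih =>
  intro S hS D
  rcases S.eq_empty_or_nonempty with rfl | ⟨v, hv⟩
  · exact ⟨0, fun _ => ∅, 0, by simp, by simp, by simp⟩
  have hnpos : 0 < n := hS ▸ Finset.card_pos.2 ⟨v, hv⟩
  have key : ∀ E : OrientedGraph V, 2 * (S.filter (fun u => E.arc u v)).card + 1 ≤ n →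
      E.Dec S (n - Nat.clog 2 (n + 1)) := by
    intro E hE
    set U := S.filter (fun u => E.arc u v) with hU
    have hvU : v ∉ U := by simp [hU, E.irrefl' v]
    let W := (S.erase v) \ U
    have hUs : U ⊆ S.erase v := by
      intro x hx
      refine Finset.mem_erase.2 ⟨fun e => hvU (e ▸ hx), (Finset.mem_filter.1 hx).1⟩
    have hWc : W.card = n - 1 - U.card := by
      rw [Finset.card_sdiff_of_subset hUs, Finset.card_erase_of_mem hv, hS]
    have := Dec.step (W := W) (v := v) (by simp [W]) (ih _ (by omega) W hWc) U E hvU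
      Finset.disjoint_sdiff (fun u hu => (Finset.mem_filter.1 hu).2) (by
        intro w hw h
        simp only [W, Finset.mem_sdiff, Finset.mem_erase, hU, Finset.mem_filter] at hw
        tauto)
    have hSe : U ∪ insert v W = S := by
      rw [Finset.union_insert, Finset.union_sdiff_of_subset hUs, Finset.insert_erase hv]
    rw [hSe] at this
    exact this.mono (clog_step n _ hE)
  by_cases h : 2 * (S.filter (fun u => D.arc u v)).card + 1 ≤ n
  · exact key D h
  · apply Dec.of_rev
    apply key
    have hd : Disjoint (S.filter (fun u => D.arc u v)) (S.filter (fun u => D.rev.arc u v)) := by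
      rw [Finset.disjoint_filter]
      intro x _ h1 h2
      exact D.asymm' _ _ h1 h2
    have hsub : (S.filter (fun u => D.arc u v)) ∪ (S.filter (fun u => D.rev.arc u v))
        ⊆ S.erase v := by
      intro x hx
      simp only [Finset.mem_union, Finset.mem_filter] at hx
      refine Finset.mem_erase.2 ⟨?_, by tauto⟩
      rintro rfl
      have := D.irrefl' x
      have := D.rev.irrefl' x
      tauto
    have := Finset.card_le_card hsub
    rw [Finset.card_union_of_disjoint hd, Finset.card_erase_of_mem hv, hS] at this
    omega

lemma exists_decycling_s3 (n : ℕ) (T : OrientedGraph (Fin n)) :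
    ∃ (k : ℕ) (X : Fin k → Set (Fin n)), T.IsDecycling X ∧ k ≤ n - Nat.clog 2 (n + 1) := by
  obtain ⟨k, X, r, h1, -, h3⟩ := dec_all n (Finset.univ : Finset (Fin n)) (by simp) T
  refine ⟨k, X, fun v hv => ?_, h1⟩
  have : ∀ a b, Relation.TransGen (T.invert X).arc a b → r a < r b := by
    intro a b h
    induction h with
    | single h => exact h3 _ (by simp) _ (by simp) h
    | tail _ h ih => exact ih.trans (h3 _ (by simp) _ (by simp) h)
  exact lt_irrefl _ (this v v hv)

end OrientedGraph

/-- For every positive integer `n`, `inv(n) ≤ n - ⌈log₂ (n+1)⌉`; that is,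
every tournament of order `n` has a decycling family of size at most `n - ⌈log₂ (n+1)⌉`.
(Here `Nat.clog 2 (n+1) = ⌈log₂ (n+1)⌉`.) -/
theorem maxInv_upper_bound (n : ℕ) (hn : 1 ≤ n) :
    maxInv n ≤ n - Nat.clog 2 (n + 1) ∧
      ∀ T : OrientedGraph (Fin n), T.IsTournament →
        ∃ (k : ℕ) (X : Fin k → Set (Fin n)), T.IsDecycling X ∧
          k ≤ n - Nat.clog 2 (n + 1) := by
  refine ⟨?_, fun T _ => T.exists_decycling_s3 n⟩
  apply csSup_le'
  rintro m ⟨T, -, rfl⟩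
  obtain ⟨k, X, h, hk⟩ := T.exists_decycling_s3 n
  have hle : T.inv ≤ k := Nat.sInf_le ⟨X, h⟩
  exact hle.trans hk
end
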